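/- Let q be a prime power, let d > 1 be an odd divisor of q+1, let u be a proper divisor of d (u divides d and u < d), let t be a positive integer, and set n = d^t·u. Let δ be an element of the finite field F_{q²} whose multiplicative order is q+1, and let g_n(X) = ((δ·X − 1)^n − δ·(X − δ)^n)/(δ^n − δ) over F_{q²}. Then for all nonzero x, y ∈ F_{q²} and every λ ∈ F_{q²} with λ^q = λ, the equality x^n · g_n(x^{q−1}) = λ · y^n · g_n(y^{q−1}) implies that there exists μ ∈ F_{q²} with μ^q = μ and x = μ·y (i.e. x/y lies in the subfield F_q). -/

import Mathlib

/-- In a field of order `q ^ 2` with `q = p ^ e`, raising to the power `q` is a ring endomorphism. -/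
theorem exists_ringHom_eq_pow {F : Type*} [Field F] [Fintype F] {p e q : ℕ} (hp : p.Prime) (hq : q = p ^ e)
    (hF : Fintype.card F = q ^ 2) :
    ∃ φ : F →+* F, ∀ a, φ a = a ^ q := by
  have := Fact.mk hp
  have hcard : Fintype.card F = p ^ (e * 2) := by rw [hF, hq, pow_mul]
  have : CharP F p := by
    obtain ⟨r, hr⟩ := CharP.exists F
    obtain ⟨m, hrp, hm⟩ := FiniteField.card F r
    have hdvd : r ∣ p ^ (e * 2) := by
      rw [← hcard, hm]
      exact dvd_pow_self r m.pos.ne'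
    rwa [(Nat.prime_dvd_prime_iff_eq hrp hp).mp (hrp.dvd_of_dvd_pow hdvd)] at hr
  exact ⟨iterateFrobenius F p e, fun a => by rw [iterateFrobenius_def, hq]⟩

/-- An odd divisor of `q + 1` is coprime to `q - 1`. -/
theorem coprime_sub_one_of_odd_of_dvd_add_one {d q : ℕ} (hq : 0 < q) (hodd : Odd d)
    (hdvd : d ∣ q + 1) : Nat.Coprime d (q - 1) := by
  have h1 : Nat.gcd d (q - 1) ∣ 2 := by
    have := Nat.dvd_sub ((Nat.gcd_dvd_left d (q - 1)).trans hdvd) (Nat.gcd_dvd_right d (q - 1))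
    rwa [show q + 1 - (q - 1) = 2 by omega] at this
  have h2 : Nat.Coprime d 2 := hodd.coprime_two_right
  exact Nat.eq_one_of_dvd_coprimes h2 (Nat.gcd_dvd_left _ _) h1

/-- If `v` and `w` are scaled by the same factor under `a ↦ a ^ q` and `n` is coprime to `q - 1`,
then `v ^ n = w ^ n` forces `v = w`. -/
theorem eq_of_pow_eq_pow_of_coprime_sub_one {F : Type*} [Field F] {q n : ℕ} (hq : 0 < q)
    (hn : n ≠ 0) (hcop : Nat.Coprime n (q - 1)) {c v w : F} (hc : c ≠ 0)
    (hv : c * v ^ q = v) (hw : c * w ^ q = w) (h : v ^ n = w ^ n) : v = w := by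
  rcases eq_or_ne w 0 with rfl | hw0
  · rw [zero_pow hn] at h
    exact eq_zero_of_pow_eq_zero h
  have hone : v / w = 1 := by
    have hpn : (v / w) ^ n = 1 := by rw [div_pow, h, div_self (pow_ne_zero _ hw0)]
    have hpq : (v / w) ^ q = v / w := by
      rw [div_pow, div_eq_div_iff (pow_ne_zero _ hw0) hw0]
      apply mul_left_cancel₀ hc
      linear_combination w * hv - v * hw
    have hne : v / w ≠ 0 := by
      intro h0
      rw [h0, zero_pow hn] at hpn
      exact zero_ne_one hpn
    have hpq' : (v / w) ^ (q - 1) = 1 := by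
      apply mul_right_cancel₀ hne
      rw [← pow_succ, Nat.sub_add_cancel hq, hpq, one_mul]
    have := pow_gcd_eq_one.mpr ⟨hpn, hpq'⟩
    rwa [hcop.gcd_eq_one, pow_one] at this
  rwa [div_eq_one_iff_eq hw0] at hone


open Polynomial in
theorem stmt_9 (p e q : ℕ) (hp : p.Prime) (he : 0 < e) (hq : q = p ^ e)
    (F : Type*) [Field F] [Fintype F] (hF : Fintype.card F = q ^ 2)
    (d : ℕ) (hd : 1 < d) (hodd : Odd d) (hdvd : d ∣ q + 1)
    (u : ℕ) (hu : u ∣ d) (hud : u < d)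
    (t : ℕ) (ht : 0 < t) (n : ℕ) (hn : n = d ^ t * u)
    (δ : F) (hδ : orderOf δ = q + 1)
    (g : Polynomial F)
    (hg : g = C (δ ^ n - δ)⁻¹ * ((C δ * X - 1) ^ n - C δ * (X - C δ) ^ n)) :
    ∀ x y : F, x ≠ 0 → y ≠ 0 → ∀ l : F, l ^ q = l →
      x ^ n * g.eval (x ^ (q - 1)) = l * (y ^ n * g.eval (y ^ (q - 1))) →
      ∃ μ : F, μ ^ q = μ ∧ x = μ * y := by
  have hq0 : 0 < q := hq ▸ pow_pos hp.pos e
  have hq1 : 1 < q := hq ▸ Nat.one_lt_pow he.ne' hp.one_lt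
  obtain ⟨φ, hφ⟩ := exists_ringHom_eq_pow (F := F) hp hq hF
  have hφφ (a : F) : φ (φ a) = a := by
    rw [hφ, hφ, ← pow_mul, ← sq, ← hF, FiniteField.pow_card]
  have hd0 : d ≠ 0 := by omega
  have hu0 : u ≠ 0 := ne_zero_of_dvd_ne_zero hd0 hu
  have hn0 : n ≠ 0 := hn ▸ mul_ne_zero (pow_ne_zero _ hd0) hu0
  have hcop : Nat.Coprime n (q - 1) := by
    have h := coprime_sub_one_of_odd_of_dvd_add_one hq0 hodd hdvd
    exact hn ▸ (h.pow_left t).mul_left (h.coprime_dvd_left hu)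
  have hδφ : δ * φ δ = 1 := by rw [hφ, ← pow_succ', ← hδ, pow_orderOf_eq_one]
  have hδ0 : δ ≠ 0 := left_ne_zero_of_mul_eq_one hδφ
  have hδ2 : δ ^ 2 - 1 ≠ 0 := by
    intro h
    have := Nat.le_of_dvd two_pos (orderOf_dvd_of_pow_eq_one (sub_eq_zero.mp h))
    omega
  have hδn : δ ^ n - δ ≠ 0 := by
    intro h
    have h1 : δ ^ (n - 1) = 1 := by
      apply mul_right_cancel₀ hδ0
      rw [← pow_succ, Nat.sub_add_cancel (Nat.pos_of_ne_zero hn0), one_mul, sub_eq_zero.mp h]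
    have h2 : d ∣ n - 1 := hdvd.trans (hδ ▸ orderOf_dvd_of_pow_eq_one h1)
    have h3 : d ∣ n := hn ▸ (dvd_pow_self d ht.ne').mul_right u
    have h4 := Nat.dvd_sub h3 h2
    rw [show n - (n - 1) = 1 by omega] at h4
    exact hd.ne' (Nat.dvd_one.mp h4)
  have heval (x : F) : x ^ n * g.eval (x ^ (q - 1)) =
      (δ ^ n - δ)⁻¹ * ((δ * φ x - x) ^ n - δ * (φ x - δ * x) ^ n) := by
    have hx : φ x = x ^ (q - 1) * x := by rw [hφ, ← pow_succ, Nat.sub_add_cancel hq0]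
    have h1 : δ * φ x - x = (δ * x ^ (q - 1) - 1) * x := by rw [hx]; ring
    have h2 : φ x - δ * x = (x ^ (q - 1) - δ) * x := by rw [hx]; ring
    rw [h1, h2, mul_pow, mul_pow, hg]
    simp only [eval_mul, eval_sub, eval_pow, eval_C, eval_X, eval_one]
    ring
  have hA (x : F) : δ * φ (δ * φ x - x) = -(δ * φ x - x) := by
    rw [map_sub, map_mul, hφφ]
    linear_combination x * hδφ
  have hB (x : F) : δ * φ (φ x - δ * x) = -(φ x - δ * x) := by
    rw [map_sub, map_mul, hφφ]
    linear_combination -φ x * hδφ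
  intro x y hx hy l hl h
  rw [heval, heval] at h
  have hdet : (δ * φ x - x) * (φ y - δ * y) - (δ * φ y - y) * (φ x - δ * x) =
      (δ ^ 2 - 1) * (x * φ y - φ x * y) := by ring
  have hAx := hA x
  have hBx := hB x
  have hAy := hA y
  have hBy := hB y
  generalize δ * φ x - x = a at *
  generalize φ x - δ * x = b at *
  generalize δ * φ y - y = a' at *
  generalize φ y - δ * y = b' at *
  have hmain : (a ^ n - l * a' ^ n) - δ * (b ^ n - l * b' ^ n) = 0 := by
    apply mul_left_cancel₀ (inv_ne_zero hδn)
    linear_combination h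
  have hpow {c : F} (hc : δ * φ c = -c) : δ ^ n * φ c ^ n = (-1) ^ n * c ^ n := by
    rw [← mul_pow, hc, neg_pow]
  have hconj : δ * (a ^ n - l * a' ^ n) - (b ^ n - l * b' ^ n) = 0 := by
    have h1 := congrArg φ hmain
    simp only [map_sub, map_mul, map_pow, map_zero] at h1
    rw [show φ l = l from (hφ l).trans hl] at h1
    apply mul_left_cancel₀ (pow_ne_zero n (neg_ne_zero.mpr (one_ne_zero (α := F))))
    linear_combination δ ^ n * δ * h1 - δ * hpow hAx + δ * l * hpow hAy
      + δ * φ δ * hpow hBx - δ * φ δ * l * hpow hBy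
      + (-1) ^ n * (b ^ n - l * b' ^ n) * hδφ
  have hb : b ^ n - l * b' ^ n = 0 := by
    apply mul_left_cancel₀ hδ2
    linear_combination hconj - δ * hmain
  have ha : a ^ n - l * a' ^ n = 0 := by linear_combination hmain + δ * hb
  have hab : a * b' = a' * b := by
    refine eq_of_pow_eq_pow_of_coprime_sub_one hq0 hn0 hcop (pow_ne_zero 2 hδ0) ?_ ?_ ?_
    · rw [← hφ, map_mul]
      linear_combination δ * φ b' * hAx - a * hBy
    · rw [← hφ, map_mul]
      linear_combination δ * φ b * hAy - a' * hBx
    · rw [mul_pow, mul_pow]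
      linear_combination b' ^ n * ha - a' ^ n * hb
  have hxy : x * φ y - φ x * y = 0 := by
    apply mul_left_cancel₀ hδ2
    linear_combination hab - hdet
  refine ⟨x / y, ?_, (div_mul_cancel₀ x hy).symm⟩
  rw [div_pow, ← hφ, ← hφ, div_eq_div_iff (by simpa using hy) hy]
  linear_combination -hxy
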